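/- For a word x_1⋯x_r, there exists a path in the Ufnarovskii graph Q labeled x_1⋯x_r if and only if there exists a legal word v of length ℓ such that the concatenation x_1⋯x_r v is a legal word. -/

import Mathlib

/-! Basic setup for monomial algebras and the Ufnarovskii graph.

`G` is the set of letters, words are elements obtained as lists of letters,
`F` is the finite set of forbidden words.  A word is illegal if it contains a
forbidden word as a contiguous subword (equivalently, lies in the two-sided
ideal generated by `F`), and legal otherwise.  The Ufnarovskii graph has the
legal words of length `ℓ` as vertices and the legal words of length `ℓ + 1`
as arrows, where the arrow corresponding to such a word `w` goes from the
word consisting of the first `ℓ` letters of `w` to the word consisting of the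
last `ℓ` letters of `w`, and is labeled by the first letter of `w`. -/

namespace Ufnarovskii

variable {G : Type}

/-- A word is *illegal* if it contains a forbidden word as a contiguous subword;
equivalently, if it lies in the two-sided ideal generated by the forbidden words. -/
def Illegal (F : Finset (List G)) (w : List G) : Prop :=
  ∃ u t v, t ∈ F ∧ w = u ++ t ++ v

/-- A word is *legal* if it is not illegal. -/
def Legal (F : Finset (List G)) (w : List G) : Prop :=
  ¬ Illegal F w

/-- The vertices of the Ufnarovskii graph: legal words of length `ℓ`. -/
def Vert (F : Finset (List G)) (ℓ : ℕ) : Type :=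
  {w : List G // Legal F w ∧ w.length = ℓ}

/-- The quiver structure on the Ufnarovskii graph: an arrow from `s` to `t` is
(the datum of) a legal word `w` of length `ℓ + 1` whose first `ℓ` letters form `s`
and whose last `ℓ` letters form `t` (that is, `w = s ++ [y] = [x] ++ t` for some
letters `x`, `y`). -/
instance instQuiverVert (F : Finset (List G)) (ℓ : ℕ) : Quiver (Vert F ℓ) where
  Hom s t := {w : List G // Legal F w ∧ w.length = ℓ + 1 ∧ w.take ℓ = s.1 ∧ w.drop 1 = t.1}

/-- The label of an arrow, as a one-letter word: the first letter of the
corresponding legal word of length `ℓ + 1`. -/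
def arrowLabel {F : Finset (List G)} {ℓ : ℕ} {s t : Vert F ℓ} (a : s ⟶ t) : List G :=
  a.1.take 1

/-- The label of a path: the concatenation of the labels of its arrows. -/
def pathLabel {F : Finset (List G)} {ℓ : ℕ} {s : Vert F ℓ} :
    ∀ {t : Vert F ℓ}, Quiver.Path s t → List G
  | _, Quiver.Path.nil => []
  | _, Quiver.Path.cons p a => pathLabel p ++ arrowLabel a

end Ufnarovskii

namespace Ufnarovskii

variable {G : Type} {F : Finset (List G)} {ℓ : ℕ}

theorem legal_iff {w : List G} : Legal F w ↔ ∀ f ∈ F, ¬ f <:+: w := by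
  constructor
  · rintro h f hf ⟨u, v, rfl⟩
    exact h ⟨u, f, v, hf, rfl⟩
  · rintro h ⟨u, f, v, hf, rfl⟩
    exact h f hf ⟨u, v, rfl⟩

theorem Legal.of_infix {v w : List G} (h : Legal F w) (hv : v <:+: w) : Legal F v :=
  legal_iff.2 fun f hf hfv => legal_iff.1 h f hf (hfv.trans hv)

/-- Legal words overlapping in a word of length at least `ℓ` can be glued along it. -/
theorem Legal.append_concat (hlen : ∀ w ∈ F, w.length ≤ ℓ + 1) {u m : List G} {y : G}
    (hm : ℓ ≤ m.length) (hum : Legal F (u ++ m)) (hmy : Legal F (m ++ [y])) :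
    Legal F (u ++ (m ++ [y])) := by
  refine legal_iff.2 fun f hf hfi => ?_
  rw [← List.append_assoc, List.infix_concat_iff] at hfi
  rcases hfi with hfi | hfi
  · rw [List.append_assoc] at hfi
    refine legal_iff.1 hmy f hf
      (List.suffix_of_suffix_length_le hfi (List.suffix_append _ _) ?_).isInfix
    have := hlen f hf
    simp only [List.length_append, List.length_singleton]
    omega
  · exact legal_iff.1 hum f hf hfi

theorem pathLabel_comp {s t r : Vert F ℓ} (p : Quiver.Path s t) (q : Quiver.Path t r) :
    pathLabel (p.comp q) = pathLabel p ++ pathLabel q := by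
  induction q with
  | nil => simp [pathLabel]
  | cons q a ih => simp [pathLabel, ih]

theorem legal_pathLabel_append (hlen : ∀ w ∈ F, w.length ≤ ℓ + 1) {s t : Vert F ℓ}
    (p : Quiver.Path s t) : Legal F (pathLabel p ++ t.1) := by
  induction p with
  | nil => simpa [pathLabel] using s.2.1
  | @cons b c p a ih =>
    obtain ⟨w, hw, hwl, hb, hc⟩ := a
    have hlabel : w.take 1 ++ c.1 = w := by rw [← hc, List.take_append_drop]
    obtain ⟨y, hy⟩ : ∃ y, w.drop ℓ = [y] :=
      List.length_eq_one_iff.1 (by rw [List.length_drop]; omega)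
    have hwy : w = b.1 ++ [y] := by rw [← hb, ← hy, List.take_append_drop]
    simp only [pathLabel, arrowLabel, List.append_assoc]
    rw [hlabel, hwy]
    exact Legal.append_concat hlen b.2.2.ge ih (hwy ▸ hw)

theorem exists_path_of_legal_append {v : List G} (hv : v.length = ℓ) (xs : List G)
    (h : Legal F (xs ++ v)) :
    ∃ s t : Vert F ℓ, s.1 = (xs ++ v).take ℓ ∧ ∃ p : Quiver.Path s t, pathLabel p = xs := by
  induction xs with
  | nil => exact ⟨⟨v, h, hv⟩, ⟨v, h, hv⟩, by simp [← hv], .nil, rfl⟩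
  | cons x xs ih =>
    obtain ⟨s, t, hs, p, hp⟩ := ih (h.of_infix (List.suffix_cons x (xs ++ v)).isInfix)
    let r : Vert F ℓ := ⟨(x :: xs ++ v).take ℓ,
      h.of_infix (List.take_prefix _ _).isInfix, by simp; omega⟩
    let a : r ⟶ s := ⟨(x :: xs ++ v).take (ℓ + 1),
      h.of_infix (List.take_prefix _ _).isInfix, by simp; omega,
      by rw [List.take_take, min_eq_left (Nat.le_succ ℓ)], by simp [hs]⟩
    refine ⟨r, t, rfl, a.toPath.comp p, ?_⟩
    rw [pathLabel_comp, hp]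
    simp [Quiver.Hom.toPath, pathLabel, arrowLabel, a]

end Ufnarovskii

open Ufnarovskii in
/-- For a word `x₁⋯x_r`, there exists a path in the Ufnarovskii graph labeled
`x₁⋯x_r` if and only if there exists a legal word `v` of length `ℓ` such that the
concatenation `x₁⋯x_r v` is a legal word. -/
theorem statement_8 {G : Type} (F : Finset (List G)) (ℓ : ℕ)
    (hlen : ∀ w ∈ F, 2 ≤ w.length ∧ w.length ≤ ℓ + 1) (hmax : ∃ w ∈ F, w.length = ℓ + 1)
    (xs : List G) :
    (∃ (s t : Vert F ℓ) (p : Quiver.Path s t), pathLabel p = xs) ↔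
      (∃ v : List G, Legal F v ∧ v.length = ℓ ∧ Legal F (xs ++ v)) := by
  constructor
  · rintro ⟨s, t, p, rfl⟩
    exact ⟨t.1, t.2.1, t.2.2, legal_pathLabel_append (fun w hw => (hlen w hw).2) p⟩
  · rintro ⟨v, -, hv, h⟩
    obtain ⟨s, t, -, p, hp⟩ := exists_path_of_legal_append hv xs h
    exact ⟨s, t, p, hp⟩
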